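/- For every x ∈ ℝ, lim_{r→0⁺} ( Σ_{λ : λ_1 ≤ r^{−1} ln(r^{−1}) + x r^{−1}} e^{−r|λ|} ) / ( Σ_{λ} e^{−r|λ|} ) = exp(−e^{−x}), where the sums run over all partitions λ and λ_1 denotes the largest part. That is, under the canonical measure on partitions with q = e^{−r}, the largest part, centered at r^{−1} ln r^{−1} and scaled by r^{−1}, converges in distribution to the Gumbel law as r → 0⁺. -/

import Mathlib

/-- An integer partition: a weakly decreasing sequence of nonnegative integers with only
finitely many nonzero terms; `part i` is the `(i+1)`-st part `λ_{i+1}`. -/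
structure IntPartition where
  part : ℕ → ℕ
  antitone : Antitone part
  finite_supp : (Function.support part).Finite

/-- The size `|λ| = Σ_i λ_i` of a partition. -/
noncomputable def IntPartition.size (lam : IntPartition) : ℕ := ∑ᶠ i, lam.part i

namespace IntPartition

@[ext]
theorem ext {lam mu : IntPartition} (h : ∀ i, lam.part i = mu.part i) : lam = mu := by
  cases lam
  cases mu
  congr
  exact funext h

theorem exists_part_eq_zero (lam : IntPartition) : ∃ n, lam.part n = 0 := by
  obtain ⟨n, hn⟩ := lam.finite_supp.exists_notMem
  exact ⟨n, by simpa using hn⟩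

theorem size_eq_sum_range (lam : IntPartition) {n : ℕ} (hn : lam.part n = 0) :
    lam.size = ∑ i ∈ Finset.range n, lam.part i := by
  refine finsum_eq_sum_of_support_subset _ fun i hi => ?_
  simp only [Finset.coe_range, Set.mem_Iio]
  by_contra! h
  have := lam.antitone h
  simp only [Function.mem_support] at hi
  omega

/-- The partition obtained from `mu` by putting `k` parts equal to `c` in front. -/
def prepend (c k : ℕ) (mu : IntPartition) (h : mu.part 0 ≤ c) : IntPartition where
  part i := if i < k then c else mu.part (i - k)
  antitone i j hij := by
    have h₁ := mu.antitone (Nat.zero_le (j - k))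
    have h₂ := mu.antitone (Nat.sub_le_sub_right hij k)
    dsimp only
    split_ifs <;> omega
  finite_supp := by
    obtain ⟨n, hn⟩ := mu.exists_part_eq_zero
    refine (Set.finite_Iio (k + n)).subset fun i hi => ?_
    by_contra! h'
    simp only [Set.mem_Iio, not_lt] at h'
    have := mu.antitone (show n ≤ i - k by omega)
    rw [Function.mem_support, if_neg (by omega)] at hi
    omega

theorem size_prepend (c k : ℕ) (mu : IntPartition) (h : mu.part 0 ≤ c) :
    (prepend c k mu h).size = k * c + mu.size := by
  obtain ⟨n, hn⟩ := mu.exists_part_eq_zero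
  rw [mu.size_eq_sum_range hn, size_eq_sum_range (n := k + n) _ (by simp [prepend, hn]),
    Finset.sum_range_add]
  congr 1
  · rw [Finset.sum_congr rfl (g := fun _ => c)]
    · simp
    · intro i hi
      simp [prepend, Finset.mem_range.1 hi]
  · simp [prepend]

theorem bijective_prepend (m : ℕ) :
    Function.Bijective (fun p : ℕ × {mu : IntPartition // mu.part 0 ≤ m} =>
      (⟨prepend (m + 1) p.1 p.2.1 (p.2.2.trans m.le_succ), by
        have := p.2.2
        simp only [prepend]
        split_ifs
        · rfl
        · simp only [Nat.zero_sub]; omega⟩ : {lam : IntPartition // lam.part 0 ≤ m + 1})) := by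
  constructor
  · rintro ⟨k, mu, hmu⟩ ⟨l, nu, hnu⟩ heq
    have hpart : ∀ i, (if i < k then m + 1 else mu.part (i - k)) =
        if i < l then m + 1 else nu.part (i - l) := fun i =>
      congrFun (congrArg part (congrArg Subtype.val heq)) i
    have hkl : k = l := by
      rcases lt_trichotomy k l with h | h | h
      · have := hpart k
        simp [h] at this
        omega
      · exact h
      · have := hpart l
        simp [h] at this
        omega
    subst hkl
    have : mu = nu := by
      ext i
      simpa using hpart (i + k)
    subst this
    rfl
  · rintro ⟨lam, hlam⟩
    have hex : ∃ i, lam.part i ≤ m := by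
      obtain ⟨n, hn⟩ := lam.exists_part_eq_zero
      exact ⟨n, by omega⟩
    classical
    refine ⟨⟨Nat.find hex, ⟨⟨fun i => lam.part (i + Nat.find hex),
      fun i j hij => lam.antitone (by omega),
      lam.finite_supp.preimage (add_left_injective _).injOn⟩, ?_⟩⟩, ?_⟩
    · simpa using Nat.find_spec hex
    · ext i
      simp only [prepend]
      split_ifs with h
      · have h₁ := Nat.find_min hex h
        have h₂ := lam.antitone (Nat.zero_le i)
        omega
      · rw [Nat.sub_add_cancel (not_lt.1 h)]

theorem hasSum_pow_size_subtype {q : ℝ} (hq₀ : 0 ≤ q) (hq₁ : q < 1) (m : ℕ) :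
    HasSum (fun lam : {lam : IntPartition // lam.part 0 ≤ m} => q ^ lam.1.size)
      (∏ k ∈ Finset.range m, (1 - q ^ (k + 1))⁻¹) := by
  induction m with
  | zero =>
    have hzero (lam : {lam : IntPartition // lam.part 0 ≤ 0}) (i : ℕ) : lam.1.part i = 0 := by
      have := lam.1.antitone (Nat.zero_le i)
      have := lam.2
      omega
    let z : {lam : IntPartition // lam.part 0 ≤ 0} :=
      ⟨⟨fun _ => 0, fun _ _ _ => le_rfl, by simp⟩, le_rfl⟩
    have hz : z.1.size = 0 := by simp [size_eq_sum_range (n := 0) z.1 rfl]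
    convert hasSum_single z fun lam hlam => ?_
    · simp [hz]
    · exact absurd (Subtype.ext (IntPartition.ext fun i => hzero lam i)) hlam
  | succ m ih =>
    have hgeom := hasSum_geometric_of_lt_one (pow_nonneg hq₀ (m + 1))
      (pow_lt_one₀ hq₀ hq₁ m.succ_ne_zero)
    have hmul := hgeom.mul ih (hgeom.summable.mul_of_nonneg ih.summable
      (fun _ => by positivity) (fun _ => by positivity))
    rw [Finset.prod_range_succ, mul_comm, ← (Equiv.ofBijective _ (bijective_prepend m)).hasSum_iff]
    refine (congrArg (HasSum · _) (funext fun p => ?_)).mpr hmul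
    simp only [Function.comp_apply, Equiv.ofBijective_apply, size_prepend]
    rw [pow_add, mul_comm p.1, pow_mul]

open scoped Classical in
theorem hasSum_pow_size_of_part_zero_le {q : ℝ} (hq₀ : 0 ≤ q) (hq₁ : q < 1) (m : ℕ) :
    HasSum (fun lam : IntPartition => if lam.part 0 ≤ m then q ^ lam.size else 0)
      (∏ k ∈ Finset.range m, (1 - q ^ (k + 1))⁻¹) := by
  have h := hasSum_pow_size_subtype hq₀ hq₁ m
  have := (hasSum_subtype_iff_indicator (f := fun lam : IntPartition => q ^ lam.size)
    (s := {lam : IntPartition | lam.part 0 ≤ m})).1 h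
  convert this using 2 with lam
  rw [Set.indicator_apply]
  rfl

end IntPartition

theorem Real.exp_neg_div_one_sub_le {y b : ℝ} (hy : 0 ≤ y) (hyb : y ≤ b) (hb : b < 1) :
    Real.exp (-(y / (1 - b))) ≤ 1 - y := by
  have hy₁ : 0 < 1 - y := by linarith
  have h₁ : y / (1 - y) ≤ y / (1 - b) :=
    div_le_div_of_nonneg_left hy (by linarith) (by linarith)
  rw [Real.exp_neg]
  refine inv_le_of_inv_le₀ hy₁ ?_
  calc (1 - y)⁻¹ = y / (1 - y) + 1 := by field_simp; ring
    _ ≤ Real.exp (y / (1 - y)) := Real.add_one_le_exp _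
    _ ≤ Real.exp (y / (1 - b)) := Real.exp_le_exp.2 h₁

theorem sum_Ico_pow_succ {q : ℝ} (hq : q < 1) {m N : ℕ} (h : m ≤ N) :
    ∑ k ∈ Finset.Ico m N, q ^ (k + 1) = (q ^ (m + 1) - q ^ (N + 1)) / (1 - q) := by
  simp_rw [pow_succ, ← Finset.sum_mul]
  rw [geom_sum_Ico' hq.ne h]
  ring

theorem exp_le_prod_Ico_one_sub_pow {q : ℝ} (hq₀ : 0 ≤ q) (hq₁ : q < 1) {m N : ℕ} (h : m ≤ N) :
    Real.exp (-(q ^ (m + 1) / (1 - q) / (1 - q ^ (m + 1)))) ≤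
      ∏ k ∈ Finset.Ico m N, (1 - q ^ (k + 1)) := by
  have hb : q ^ (m + 1) < 1 := pow_lt_one₀ hq₀ hq₁ m.succ_ne_zero
  calc _ ≤ Real.exp (∑ k ∈ Finset.Ico m N, -(q ^ (k + 1) / (1 - q ^ (m + 1)))) := by
        rw [Real.exp_le_exp, Finset.sum_neg_distrib, neg_le_neg_iff, ← Finset.sum_div,
          sum_Ico_pow_succ hq₁ h]
        have : 0 ≤ q ^ (N + 1) := by positivity
        have : 0 < 1 - q := by linarith
        have : 0 < 1 - q ^ (m + 1) := by linarith
        gcongr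
        linarith
    _ = ∏ k ∈ Finset.Ico m N, Real.exp (-(q ^ (k + 1) / (1 - q ^ (m + 1)))) := Real.exp_sum _ _
    _ ≤ _ := by
        refine Finset.prod_le_prod (fun _ _ => (Real.exp_pos _).le) fun k hk => ?_
        refine Real.exp_neg_div_one_sub_le (by positivity) ?_ hb
        exact pow_le_pow_of_le_one hq₀ hq₁.le (by have := (Finset.mem_Ico.1 hk).1; omega)

theorem prod_Ico_one_sub_pow_le_exp {q : ℝ} (hq₀ : 0 ≤ q) (hq₁ : q < 1) {m N : ℕ} (h : m ≤ N) :
    ∏ k ∈ Finset.Ico m N, (1 - q ^ (k + 1)) ≤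
      Real.exp (-((q ^ (m + 1) - q ^ (N + 1)) / (1 - q))) := by
  rw [← sum_Ico_pow_succ hq₁ h, ← Finset.sum_neg_distrib, Real.exp_sum]
  refine Finset.prod_le_prod (fun k _ => ?_) fun k _ => Real.one_sub_le_exp_neg _
  have := pow_le_one₀ (n := k + 1) hq₀ hq₁.le
  linarith

theorem prod_range_inv_one_sub_pow_eq {q : ℝ} (hq₀ : 0 ≤ q) (hq₁ : q < 1) {m N : ℕ} (h : m ≤ N) :
    ∏ k ∈ Finset.range m, (1 - q ^ (k + 1))⁻¹ =
      (∏ k ∈ Finset.range N, (1 - q ^ (k + 1))⁻¹) * ∏ k ∈ Finset.Ico m N, (1 - q ^ (k + 1)) := by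
  rw [← Finset.prod_range_mul_prod_Ico _ h, mul_assoc, ← Finset.prod_mul_distrib,
    Finset.prod_eq_one (s := Finset.Ico m N), mul_one]
  intro k _
  have := pow_lt_one₀ hq₀ hq₁ k.succ_ne_zero
  exact inv_mul_cancel₀ (by simp only [Nat.succ_eq_add_one] at this; linarith)

namespace IntPartition

theorem summable_pow_size {q : ℝ} (hq₀ : 0 ≤ q) (hq₁ : q < 1) :
    Summable fun lam : IntPartition => q ^ lam.size := by
  classical
  have hnonneg (lam : IntPartition) : 0 ≤ q ^ lam.size := pow_nonneg hq₀ _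
  refine summable_of_sum_le (c := Real.exp (q ^ (0 + 1) / (1 - q) / (1 - q ^ (0 + 1)))) hnonneg
    fun s => ?_
  set N := s.sup fun lam => lam.part 0
  have hN := hasSum_pow_size_of_part_zero_le hq₀ hq₁ N
  have hle : ∑ lam ∈ s, q ^ lam.size ≤ ∏ k ∈ Finset.range N, (1 - q ^ (k + 1))⁻¹ := by
    rw [← hN.tsum_eq]
    refine le_trans (le_of_eq (Finset.sum_congr rfl fun lam hlam => ?_))
      (hN.summable.sum_le_tsum s fun lam _ => ?_)
    · rw [if_pos (Finset.le_sup (f := fun lam : IntPartition => lam.part 0) hlam)]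
    · split_ifs
      exacts [hnonneg lam, le_rfl]
  refine hle.trans ?_
  rw [Finset.prod_inv_distrib, ← neg_neg (q ^ (0 + 1) / (1 - q) / (1 - q ^ (0 + 1))),
    Real.exp_neg, Finset.range_eq_Ico]
  exact inv_anti₀ (Real.exp_pos _) (exp_le_prod_Ico_one_sub_pow hq₀ hq₁ N.zero_le)

theorem tendsto_prod_inv_one_sub_pow {q : ℝ} (hq₀ : 0 ≤ q) (hq₁ : q < 1) :
    Filter.Tendsto (fun N => ∏ k ∈ Finset.range N, (1 - q ^ (k + 1))⁻¹) Filter.atTop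
      (nhds (∑' lam : IntPartition, q ^ lam.size)) := by
  classical
  simp_rw [← (hasSum_pow_size_of_part_zero_le hq₀ hq₁ _).tsum_eq]
  refine tendsto_tsum_of_dominated_convergence (summable_pow_size hq₀ hq₁) (fun lam => ?_)
    (Filter.Eventually.of_forall fun N lam => ?_)
  · refine tendsto_const_nhds.congr' ?_
    filter_upwards [Filter.eventually_ge_atTop (lam.part 0)] with N hN
    rw [if_pos hN]
  · have := pow_nonneg hq₀ lam.size
    split_ifs
    · rw [Real.norm_of_nonneg this]
    · simpa using this

theorem one_le_tsum_pow_size {q : ℝ} (hq₀ : 0 ≤ q) (hq₁ : q < 1) :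
    1 ≤ ∑' lam : IntPartition, q ^ lam.size := by
  classical
  have h := (hasSum_pow_size_of_part_zero_le hq₀ hq₁ 0)
  rw [Finset.prod_range_zero] at h
  refine hasSum_le (fun lam => ?_) h (summable_pow_size hq₀ hq₁).hasSum
  have := pow_nonneg hq₀ lam.size
  split_ifs
  exacts [le_rfl, this]

open scoped Classical in
/-- Bounds for the probability, under the canonical measure, that all parts are at most `m`. -/
theorem tsum_div_tsum_mem_Icc {q : ℝ} (hq₀ : 0 ≤ q) (hq₁ : q < 1) (m : ℕ) :
    (∑' lam : IntPartition, if lam.part 0 ≤ m then q ^ lam.size else 0) /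
        (∑' lam : IntPartition, q ^ lam.size) ∈
      Set.Icc (Real.exp (-(q ^ (m + 1) / (1 - q) / (1 - q ^ (m + 1)))))
        (Real.exp (-(q ^ (m + 1) / (1 - q)))) := by
  have hpos : 0 < ∑' lam : IntPartition, q ^ lam.size :=
    one_pos.trans_le (one_le_tsum_pow_size hq₀ hq₁)
  have hlim := tendsto_prod_inv_one_sub_pow hq₀ hq₁
  have hnn (N : ℕ) : 0 ≤ ∏ k ∈ Finset.range N, (1 - q ^ (k + 1))⁻¹ := by
    refine Finset.prod_nonneg fun k _ => inv_nonneg.2 ?_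
    have := pow_le_one₀ (n := k + 1) hq₀ hq₁.le
    linarith
  rw [(hasSum_pow_size_of_part_zero_le hq₀ hq₁ m).tsum_eq, Set.mem_Icc, le_div_iff₀ hpos,
    div_le_iff₀ hpos]
  constructor
  · refine le_of_tendsto (hlim.const_mul _) ?_
    filter_upwards [Filter.eventually_ge_atTop m] with N hN
    rw [prod_range_inv_one_sub_pow_eq hq₀ hq₁ hN, mul_comm]
    exact mul_le_mul_of_nonneg_left (exp_le_prod_Ico_one_sub_pow hq₀ hq₁ hN) (hnn N)
  · have hq : Filter.Tendsto (fun N : ℕ => q ^ (N + 1)) Filter.atTop (nhds 0) :=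
      (tendsto_pow_atTop_nhds_zero_of_lt_one hq₀ hq₁).comp (Filter.tendsto_add_atTop_nat 1)
    have hexp : Filter.Tendsto
        (fun N : ℕ => Real.exp (-((q ^ (m + 1) - q ^ (N + 1)) / (1 - q)))) Filter.atTop
        (nhds (Real.exp (-(q ^ (m + 1) / (1 - q))))) := by
      have := ((hq.const_sub (q ^ (m + 1))).div_const (1 - q)).neg.rexp
      rwa [sub_zero] at this
    refine ge_of_tendsto (hexp.mul hlim) ?_
    filter_upwards [Filter.eventually_ge_atTop m] with N hN
    rw [prod_range_inv_one_sub_pow_eq hq₀ hq₁ hN, mul_comm]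
    exact mul_le_mul_of_nonneg_right (prod_Ico_one_sub_pow_le_exp hq₀ hq₁ hN) (hnn N)

end IntPartition

theorem tendsto_div_one_sub_exp_neg :
    Filter.Tendsto (fun r : ℝ => r / (1 - Real.exp (-r))) (nhdsWithin 0 (Set.Ioi 0))
      (nhds 1) := by
  have h : HasDerivAt (fun r : ℝ => 1 - Real.exp (-r)) 1 0 := by
    have := ((hasDerivAt_neg (0 : ℝ)).exp).const_sub 1
    simpa using this
  have h₂ := (h.tendsto_slope_zero_right).inv₀ one_ne_zero
  simpa [div_eq_mul_inv, mul_comm] using h₂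

/-- The cutoff `⌊r⁻¹ log r⁻¹ + x r⁻¹⌋` for the largest part. -/
noncomputable def gumbelCutoff (x r : ℝ) : ℕ := ⌊r⁻¹ * Real.log r⁻¹ + x * r⁻¹⌋₊

theorem eventually_gumbelThreshold_nonneg (x : ℝ) :
    ∀ᶠ r : ℝ in nhdsWithin 0 (Set.Ioi 0), 0 ≤ r⁻¹ * Real.log r⁻¹ + x * r⁻¹ := by
  have hlog : Filter.Tendsto (fun r : ℝ => Real.log r⁻¹) (nhdsWithin 0 (Set.Ioi 0))
      Filter.atTop := Real.tendsto_log_atTop.comp tendsto_inv_nhdsGT_zero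
  filter_upwards [hlog.eventually_ge_atTop (-x), self_mem_nhdsWithin] with r hr hr₀
  have : 0 < r⁻¹ := inv_pos.2 hr₀
  have := mul_nonneg this.le (by linarith : 0 ≤ Real.log r⁻¹ + x)
  linarith

theorem exp_neg_mul_gumbelThreshold {r : ℝ} (hr : 0 < r) (x : ℝ) :
    Real.exp (-r * (r⁻¹ * Real.log r⁻¹ + x * r⁻¹)) = r * Real.exp (-x) := by
  have : -r * (r⁻¹ * Real.log r⁻¹ + x * r⁻¹) = Real.log r + -x := by
    rw [Real.log_inv]
    field_simp
    ring
  rw [this, Real.exp_add, Real.exp_log hr]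

theorem tendsto_exp_pow_gumbelCutoff_div (x : ℝ) :
    Filter.Tendsto
      (fun r : ℝ => Real.exp (-r) ^ (gumbelCutoff x r + 1) / (1 - Real.exp (-r)))
      (nhdsWithin 0 (Set.Ioi 0)) (nhds (Real.exp (-x))) := by
  have hu : Filter.Tendsto (fun r : ℝ => r / (1 - Real.exp (-r)) * Real.exp (-x))
      (nhdsWithin 0 (Set.Ioi 0)) (nhds (Real.exp (-x))) := by
    simpa using tendsto_div_one_sub_exp_neg.mul_const (Real.exp (-x))
  have he : Filter.Tendsto (fun r : ℝ => Real.exp (-r)) (nhdsWithin 0 (Set.Ioi 0)) (nhds 1) := by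
    have : Continuous fun r : ℝ => Real.exp (-r) := by fun_prop
    simpa using (this.tendsto 0).mono_left nhdsWithin_le_nhds
  have hl : Filter.Tendsto
      (fun r : ℝ => Real.exp (-r) * (r / (1 - Real.exp (-r)) * Real.exp (-x)))
      (nhdsWithin 0 (Set.Ioi 0)) (nhds (Real.exp (-x))) := by
    simpa using he.mul hu
  have hpow (r : ℝ) : Real.exp (-r) ^ (gumbelCutoff x r + 1) =
      Real.exp (-r * ((gumbelCutoff x r : ℝ) + 1)) := by
    rw [← Real.exp_nat_mul]
    push_cast
    ring_nf
  refine tendsto_of_tendsto_of_tendsto_of_le_of_le' hl hu ?_ ?_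
  · filter_upwards [eventually_gumbelThreshold_nonneg x, self_mem_nhdsWithin] with r ht hr
    have hr : 0 < r := hr
    have h₁ : 0 < 1 - Real.exp (-r) := by simpa using hr
    have h₂ : (gumbelCutoff x r : ℝ) ≤ _ := Nat.floor_le ht
    rw [div_mul_eq_mul_div, ← mul_div_assoc, ← exp_neg_mul_gumbelThreshold hr, ← Real.exp_add,
      hpow]
    gcongr
    nlinarith
  · filter_upwards [self_mem_nhdsWithin] with r hr
    have hr : 0 < r := hr
    have h₁ : 0 < 1 - Real.exp (-r) := by simpa using hr
    have h₂ : _ < (gumbelCutoff x r : ℝ) + 1 := Nat.lt_floor_add_one _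
    rw [div_mul_eq_mul_div, ← exp_neg_mul_gumbelThreshold hr, hpow]
    exact div_le_div_of_nonneg_right
      (Real.exp_le_exp.2 (mul_le_mul_of_nonpos_left h₂.le (neg_nonpos.2 hr.le))) h₁.le

theorem tendsto_exp_pow_gumbelCutoff (x : ℝ) :
    Filter.Tendsto (fun r : ℝ => Real.exp (-r) ^ (gumbelCutoff x r + 1))
      (nhdsWithin 0 (Set.Ioi 0)) (nhds 0) := by
  have h : Filter.Tendsto (fun r : ℝ => 1 - Real.exp (-r)) (nhdsWithin 0 (Set.Ioi 0))
      (nhds 0) := by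
    have : Continuous fun r : ℝ => 1 - Real.exp (-r) := by fun_prop
    simpa using (this.tendsto 0).mono_left nhdsWithin_le_nhds
  have h₂ := (tendsto_exp_pow_gumbelCutoff_div x).mul h
  rw [mul_zero] at h₂
  refine h₂.congr' ?_
  filter_upwards [self_mem_nhdsWithin] with r hr
  have hr : 0 < r := hr
  have h₁ : 0 < 1 - Real.exp (-r) := by simpa using hr
  exact div_mul_cancel₀ _ h₁.ne'

open scoped Classical in
theorem canonical_largest_part_gumbel (x : ℝ) :
    Filter.Tendsto (fun r : ℝ =>
        (∑' lam : IntPartition,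
            if (lam.part 0 : ℝ) ≤ r⁻¹ * Real.log r⁻¹ + x * r⁻¹ then
              Real.exp (-r * (lam.size : ℝ))
            else 0) /
          (∑' lam : IntPartition, Real.exp (-r * (lam.size : ℝ))))
      (nhdsWithin 0 (Set.Ioi 0)) (nhds (Real.exp (-Real.exp (-x)))) := by
  have ha := tendsto_exp_pow_gumbelCutoff_div x
  have hb := (tendsto_exp_pow_gumbelCutoff x).const_sub 1
  have hl := (ha.div hb (by simp)).neg.rexp
  rw [sub_zero, div_one] at hl
  have hmem : ∀ᶠ r : ℝ in nhdsWithin 0 (Set.Ioi 0),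
      (∑' lam : IntPartition, if (lam.part 0 : ℝ) ≤ r⁻¹ * Real.log r⁻¹ + x * r⁻¹ then
          Real.exp (-r * (lam.size : ℝ)) else 0) /
        (∑' lam : IntPartition, Real.exp (-r * (lam.size : ℝ))) ∈
      Set.Icc
        (Real.exp (-(Real.exp (-r) ^ (gumbelCutoff x r + 1) / (1 - Real.exp (-r)) /
          (1 - Real.exp (-r) ^ (gumbelCutoff x r + 1)))))
        (Real.exp (-(Real.exp (-r) ^ (gumbelCutoff x r + 1) / (1 - Real.exp (-r))))) := by
    filter_upwards [eventually_gumbelThreshold_nonneg x, self_mem_nhdsWithin] with r ht hr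
    have hr : 0 < r := hr
    have hq₁ : Real.exp (-r) < 1 := by simpa using hr
    have hpow (n : ℕ) : Real.exp (-r * (n : ℝ)) = Real.exp (-r) ^ n := by
      rw [← Real.exp_nat_mul, mul_comm]
    simp_rw [hpow, ← Nat.le_floor_iff ht]
    exact IntPartition.tsum_div_tsum_mem_Icc (Real.exp_pos _).le hq₁ (gumbelCutoff x r)
  exact tendsto_of_tendsto_of_tendsto_of_le_of_le' hl ha.neg.rexp
    (hmem.mono fun _ h => h.1) (hmem.mono fun _ h => h.2)
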